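/- arXiv:1908.11793 — 2 statements merged into one kernel-verified Lean document; each statement's English description precedes it below -/
import Mathlib

section
/- Let p be a prime, q = p^r with r ≥ 1, let k > 1 be an integer, D = p^{⌊log_p k⌋+1}, and for β ∈ 𝔽_q define 𝕡_k(β) = D^{−(q−1)} · #{ b : 𝔽_q^× → {0,1,…,D−1} : esymm_k(M_b) = β } ∈ ℚ. Suppose that 𝕡_k is not constant (i.e. not equal to 1/q everywhere), and that there exists a nonzero function v : 𝔽_q → ℚ such that ∑_{γ ∈ 𝔽_q} 𝕡_k(β − γ) · v(γ) = 0 for every β ∈ 𝔽_q. Then there exist an integer j ≥ 1 and a function F : 𝔽_q^j → 𝔽_q such that F is not balanced and yet for every γ ∈ 𝔽_q the real sequence (1/q^n) · #{x ∈ 𝔽_q^n : e_k(x) + F(x_1,…,x_j) = γ} (defined for n ≥ j) converges to 1/q as n → ∞. -/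
open Filter Topology

/-- The elementary symmetric polynomial of degree `k` evaluated at `x ∈ K^n`. -/
def evalE {K : Type*} [CommSemiring K] {n : ℕ} (k : ℕ) (x : Fin n → K) : K :=
  (Multiset.map x Finset.univ.val).esymm k

/-- `Mb b` is the multiset containing each nonzero (unit) `α` with multiplicity `b α`. -/
def Mb {K : Type*} [Monoid K] [Fintype K] [DecidableEq K] {D : ℕ}
    (b : Kˣ → Fin D) : Multiset K :=
  ∑ α : Kˣ, Multiset.replicate (b α : ℕ) (α : K)

section Aux

open Polynomial

theorem coeff_prod_one_add {R : Type*} [CommSemiring R] (s : Multiset R) (k : ℕ) :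
    (s.map fun a => (1 + C a * X : R[X])).prod.coeff k = s.esymm k := by
  induction s using Multiset.induction_on generalizing k with
  | empty =>
    cases k with
    | zero => simp [Multiset.esymm]
    | succ k => simp [Multiset.esymm, coeff_one, Multiset.powersetCard_zero_right]
  | cons a s ih =>
    rw [Multiset.map_cons, Multiset.prod_cons, add_mul, one_mul, coeff_add, mul_assoc, coeff_C_mul]
    cases k with
    | zero => simp [Multiset.esymm, ih]
    | succ k => 
      rw [coeff_X_mul, ih, ih]
      simp [Multiset.esymm, Multiset.powersetCard_cons, Multiset.sum_map_mul_left]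

theorem exists_fiber {A B : Type*} [Fintype A] [Fintype B] [DecidableEq B] (m : B → ℕ)
    (h : ∑ b, m b = Fintype.card A) :
    ∃ F : A → B, ∀ b, (Finset.univ.filter (fun a => F a = b)).card = m b := by
  have e : A ≃ Σ b, Fin (m b) := Fintype.equivOfCardEq (by simp [h])
  refine ⟨fun a => (e a).1, fun b => ?_⟩
  rw [← Fintype.card_subtype]
  have := (e.subtypeEquiv (p := fun a => (e a).1 = b) (q := fun s => s.1 = b)
    (fun a => Iff.rfl)).trans (Equiv.sigmaSubtype b)
  rw [Fintype.card_congr this]; simp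

/-- one step of the walk -/
def stp {K : Type*} [Monoid K] [DecidableEq K] (D : ℕ) [NeZero D] (x : K) : Kˣ → Fin D :=
  fun u => if (u : K) = x then 1 else 0

theorem fin_nsmul_one (D : ℕ) [NeZero D] (n : ℕ) : ((n • (1 : Fin D) : Fin D) : ℕ) = n % D := by
  induction n with
  | zero => simp
  | succ n ih => rw [succ_nsmul, Fin.val_add, ih, Fin.val_one']; simp

theorem addChar_sum {G ι : Type*} [AddCommGroup G] (χ : AddChar G ℂ) (s : Finset ι) (f : ι → G) :
    χ (∑ i ∈ s, f i) = ∏ i ∈ s, χ (f i) := by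
  classical
  induction s using Finset.induction_on with
  | empty => simp
  | insert a s ha ih => rw [Finset.sum_insert ha, Finset.prod_insert ha, AddChar.map_add_eq_mul, ih]

theorem char_lt {K : Type*} [Field K] [Fintype K] [DecidableEq K] (D : ℕ) [NeZero D]
    (χ : AddChar (Kˣ → Fin D) ℂ) (hχ : χ ≠ 0) :
    ‖(∑ x : K, χ (stp D x)) / (Fintype.card K : ℂ)‖ < 1 := by
  have hn : ∀ g, ‖χ g‖ = 1 := fun g => χ.norm_apply g
  have h0 : χ (stp D (0:K)) = 1 := by
    have : stp D (0:K) = 0 := by ext u; simp [stp]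
    rw [this, AddChar.map_zero_eq_one]
  obtain ⟨u, hu⟩ : ∃ u : Kˣ, χ (stp D (u:K)) ≠ 1 := by
    by_contra! hc
    apply hχ
    ext g
    have hg : g = ∑ u : Kˣ, (g u : ℕ) • stp D (u : K) := by
      funext w
      rw [Finset.sum_apply, Finset.sum_eq_single w]
      · apply Fin.ext
        simp [stp, fin_nsmul_one, Nat.mod_eq_of_lt]
      · intro b _ hb
        simp [stp, Units.ext_iff.not.1 hb.symm]
      · simp
    rw [hg, addChar_sum]
    simp [AddChar.map_nsmul_eq_pow, hc]
  have hq : (0:ℝ) < Fintype.card K := by exact_mod_cast Fintype.card_pos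
  have := norm_sum_lt_of_strictConvexSpace (t := (Finset.univ : Finset K)) 
    (w := fun _ => (1 / (Fintype.card K : ℝ))) (z := fun x => χ (stp D x)) (r := 1) (i := 0) (j := (u : K))
    (fun _ _ => by positivity) (by simp [hq.ne']) (by simp) (by simp) (by rw [h0]; exact hu.symm)
    (by positivity) (by positivity) (fun i _ => (hn _).le)
  suffices he : (∑ x : K, χ (stp D x)) / (Fintype.card K : ℂ)
      = ∑ x : K, (1 / (Fintype.card K : ℝ)) • χ (stp D x) by
    rw [he]; exact this
  rw [Finset.sum_div]
  refine Finset.sum_congr rfl fun x _ => ?_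
  rw [Complex.real_smul]; push_cast; ring

theorem walk_tendsto {K : Type*} [Field K] [Fintype K] [DecidableEq K] (D : ℕ) [NeZero D]
    (A : (Kˣ → Fin D) → Prop) [DecidablePred A] :
    Tendsto (fun n : ℕ => ((Finset.univ.filter (fun y : Fin n → K => A (∑ i, stp D (y i)))).card : ℝ)
      / (Fintype.card K : ℝ) ^ n) atTop
      (𝓝 (((Finset.univ.filter A).card : ℝ) / Fintype.card (Kˣ → Fin D))) := by
  have key : ∀ n : ℕ, ((((Finset.univ.filter (fun y : Fin n → K => A (∑ i, stp D (y i)))).card : ℝ)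
      / (Fintype.card K : ℝ) ^ n : ℝ) : ℂ) = (Fintype.card (Kˣ → Fin D) : ℂ)⁻¹ *
      ∑ g ∈ Finset.univ.filter A, ∑ χ : AddChar (Kˣ → Fin D) ℂ, χ (-g) *
        ((∑ x : K, χ (stp D x)) / (Fintype.card K : ℂ)) ^ n := by
    intro n
    have hG : (Fintype.card (Kˣ → Fin D) : ℂ) ≠ 0 := by exact_mod_cast Fintype.card_ne_zero
    have hq : (Fintype.card K : ℂ) ≠ 0 := by exact_mod_cast Fintype.card_ne_zero
    have h1 : ∀ g : Kˣ → Fin D, ∑ χ : AddChar (Kˣ → Fin D) ℂ, χ (-g) *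
        ((∑ x : K, χ (stp D x)) / (Fintype.card K : ℂ)) ^ n = 
        ∑ y : Fin n → K, (if g = ∑ i, stp D (y i) then (Fintype.card (Kˣ → Fin D) : ℂ) else 0) 
          / (Fintype.card K : ℂ) ^ n := by
      intro g
      have h2 : ∀ χ : AddChar (Kˣ → Fin D) ℂ, χ (-g) *
        ((∑ x : K, χ (stp D x)) / (Fintype.card K : ℂ)) ^ n = 
        ∑ y : Fin n → K, χ (∑ i, stp D (y i) - g) / (Fintype.card K : ℂ) ^ n := by
        intro χ
        rw [div_pow, Fintype.sum_pow, ← Finset.sum_div, mul_div_assoc', Finset.mul_sum]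
        congr 1
        refine Finset.sum_congr rfl fun y _ => ?_
        rw [← addChar_sum, ← AddChar.map_add_eq_mul, sub_eq_neg_add]
      simp_rw [h2]
      rw [Finset.sum_comm]
      refine Finset.sum_congr rfl fun y _ => ?_
      rw [← Finset.sum_div, AddChar.sum_apply_eq_ite]
      simp only [sub_eq_zero, eq_comm]
    simp_rw [h1]
    rw [Finset.sum_comm]
    simp_rw [← Finset.sum_div, Finset.sum_ite_eq', Finset.mem_filter_univ]
    rw [← Finset.sum_filter, Finset.sum_const]
    push_cast
    rw [nsmul_eq_mul]
    field_simp
  have hlim : Tendsto (fun n : ℕ => (Fintype.card (Kˣ → Fin D) : ℂ)⁻¹ *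
      ∑ g ∈ Finset.univ.filter A, ∑ χ : AddChar (Kˣ → Fin D) ℂ, χ (-g) *
        ((∑ x : K, χ (stp D x)) / (Fintype.card K : ℂ)) ^ n) atTop
      (𝓝 ((Fintype.card (Kˣ → Fin D) : ℂ)⁻¹ *
      ∑ g ∈ Finset.univ.filter A, ∑ χ : AddChar (Kˣ → Fin D) ℂ, if χ = 0 then 1 else 0)) := by
    refine Tendsto.const_mul _ (tendsto_finsetSum _ fun g _ => tendsto_finsetSum _ fun χ _ => ?_)
    split_ifs with h
    · subst h
      have hq : (Fintype.card K : ℂ) ≠ 0 := by exact_mod_cast Fintype.card_ne_zero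
      simp [hq]
    · have := (tendsto_pow_atTop_nhds_zero_of_norm_lt_one (char_lt D χ h)).const_mul (χ (-g))
      simpa using this
  simp_rw [← key] at hlim
  have := (Complex.continuous_re.tendsto _).comp hlim
  have hr : ((Fintype.card (Kˣ → Fin D) : ℂ)⁻¹ *
      ∑ g ∈ Finset.univ.filter A, ∑ χ : AddChar (Kˣ → Fin D) ℂ, if χ = 0 then 1 else 0) =
      ((((Finset.univ.filter A).card : ℝ) / Fintype.card (Kˣ → Fin D) : ℝ) : ℂ) := by
    simp only [Finset.sum_ite_eq', Finset.mem_univ, if_true, Finset.sum_const, nsmul_eq_mul,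
      mul_one]
    rw [← div_eq_inv_mul]; norm_cast
  rw [hr] at this
  exact this

theorem evalE_eq {K : Type*} [Field K] [Fintype K] [DecidableEq K] (p s k : ℕ) [Fact p.Prime]
    [CharP K p] [NeZero (p ^ s)] (hk : k < p ^ s) {n : ℕ} (x : Fin n → K) :
    evalE k x = (Mb (∑ i, stp (p ^ s) (x i))).esymm k := by
  set D := p ^ s with hD
  let I : Ideal K[X] := Ideal.span {X ^ D}
  let w : K → K[X] ⧸ I := fun a => Ideal.Quotient.mk I (1 + C a * X)
  have hw : ∀ a, w a ^ D = 1 := by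
    intro a
    have : Ideal.Quotient.mk I ((1 + C a * X) ^ D) = Ideal.Quotient.mk I 1 := by
      rw [Ideal.Quotient.eq, hD, add_pow_char_pow, one_pow, add_sub_cancel_left, mul_pow]
      exact Ideal.mul_mem_left _ _ (Ideal.subset_span rfl)
    simpa [w] using this
  let h : (Kˣ → Fin D) → K[X] ⧸ I := fun g => ∏ u : Kˣ, w u ^ (g u : ℕ)
  have h0 : h 0 = 1 := by simp [h]
  have hadd : ∀ g g', h (g + g') = h g * h g' := by
    intro g g'
    simp only [h, ← Finset.prod_mul_distrib]
    refine Finset.prod_congr rfl fun u _ => ?_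
    rw [← pow_add, Pi.add_apply, Fin.val_add]
    conv_rhs => rw [← Nat.mod_add_div ((g u : ℕ) + g' u) D, pow_add, pow_mul, hw, one_pow, mul_one]
  have hw1 : ∀ a, w a ^ (1 % D) = w a := by
    intro a
    conv_rhs => rw [← pow_one (w a), ← Nat.mod_add_div 1 D, pow_add, pow_mul, hw, one_pow, mul_one]
  have hs : ∀ a, h (stp D a) = w a := by
    intro a
    by_cases ha : a = 0
    · subst ha; simp [h, stp, w]
    · simp only [h]
      rw [Finset.prod_eq_single (Units.mk0 a ha)]
      · simp [stp, Fin.val_one', hw1]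
      · intro b _ hb
        have : (b : K) ≠ a := fun hh => hb (Units.ext hh)
        simp [stp, this]
      · simp
  have hsum : ∀ t : Finset (Fin n), h (∑ i ∈ t, stp D (x i)) = ∏ i ∈ t, w (x i) := by
    intro t
    induction t using Finset.induction_on with
    | empty => simpa using h0
    | insert a t ha ih => rw [Finset.sum_insert ha, Finset.prod_insert ha, hadd, ih, hs]
  have hMb : ∀ g : Kˣ → Fin D,
      Ideal.Quotient.mk I (((Mb g).map fun a => (1 + C a * X : K[X])).prod) = h g := by
    intro g
    have : ((Mb g).map fun a => (1 + C a * X : K[X])).prod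
        = ∏ u : Kˣ, (1 + C (u : K) * X) ^ (g u : ℕ) := by
      have hm : (Mb g).map (fun a => (1 + C a * X : K[X]))
        = ∑ u : Kˣ, Multiset.replicate (g u : ℕ) (1 + C (u : K) * X) := by
        rw [Mb, ← Multiset.coe_mapAddMonoidHom, map_sum]
        simp
      rw [hm, Multiset.prod_sum]
      simp
    rw [this, map_prod]
    simp [h, w]
  have hfin : Ideal.Quotient.mk I
        (((Multiset.map x Finset.univ.val).map fun a => (1 + C a * X : K[X])).prod)
      = Ideal.Quotient.mk I
        (((Mb (∑ i, stp D (x i))).map fun a => (1 + C a * X : K[X])).prod) := by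
    rw [hMb, hsum, Multiset.map_map]
    change Ideal.Quotient.mk I (∏ i, (1 + C (x i) * X)) = _
    rw [map_prod]
  rw [Ideal.Quotient.eq, Ideal.mem_span_singleton] at hfin
  obtain ⟨Q, hQ⟩ := hfin
  have hc := congrArg (fun P => coeff P k) hQ
  simp only [coeff_sub, coeff_prod_one_add, coeff_X_pow_mul', not_le.2 hk, if_false] at hc
  exact sub_eq_zero.1 hc

theorem exists_counts {K : Type*} [Fintype K] (q : ℕ) (hq : 1 < q) (hK : Fintype.card K = q) 
    (v : K → ℚ) (hv0 : ∑ t, v t = 0) :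
    ∃ j : ℕ, 1 ≤ j ∧ ∃ m : K → ℕ, ∃ N : ℚ, N ≠ 0 ∧ (∀ t, (m t : ℚ) = (q : ℚ) ^ (j - 1) + N * v t) ∧
      ∑ t, m t = q ^ j := by
  classical
  let N : ℕ := ∏ t, (v t).den
  have hN : N ≠ 0 := Finset.prod_ne_zero_iff.2 fun t _ => (v t).den_nz
  have hz : ∀ t, ∃ z : ℤ, (z : ℚ) = N * v t := by
    intro t
    obtain ⟨c, hc⟩ : (v t).den ∣ N := Finset.dvd_prod_of_mem _ (Finset.mem_univ t)
    refine ⟨c * (v t).num, ?_⟩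
    rw [hc]; push_cast
    have := Rat.mul_den_eq_num (v t)
    rw [← this]; ring
  choose z hz using hz
  let J : ℕ := ∑ t, (z t).natAbs
  have hJ : ∀ t, 0 ≤ (q : ℤ) ^ J + z t := by
    intro t
    have h1 : (z t).natAbs ≤ J := Finset.single_le_sum (f := fun t => (z t).natAbs)
      (fun _ _ => Nat.zero_le _) (Finset.mem_univ t)
    have h2 : J < q ^ J := Nat.lt_pow_self hq
    have h3 : ((z t).natAbs : ℤ) < (q : ℤ) ^ J := by exact_mod_cast h1.trans_lt h2
    omega
  have hm : ∀ t, ((((q : ℤ) ^ J + z t).toNat : ℕ) : ℚ) = (q : ℚ) ^ J + N * v t := by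
    intro t
    rw [← hz, ← Int.cast_natCast, Int.toNat_of_nonneg (hJ t)]
    push_cast; rfl
  refine ⟨J + 1, by omega, fun t => ((q : ℤ) ^ J + z t).toNat, N, by exact_mod_cast hN, hm, ?_⟩
  have : ((∑ t, ((q : ℤ) ^ J + z t).toNat : ℕ) : ℚ) = (q : ℚ) ^ (J + 1) := by
    push_cast [hm]
    rw [Finset.sum_add_distrib, ← Finset.mul_sum, hv0]
    simp [hK, pow_succ']
  exact_mod_cast this

end Aux

/-- **construction of Section 3.1.** If the limiting probabilities
`𝕡_k : 𝔽_q → ℚ` of `e_k` are not all equal to `1/q` and the circulant matrix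
`(𝕡_k(β - γ))` is singular (there is a nonzero `v` in its kernel), then there exists a
non-balanced `F : 𝔽_q^j → 𝔽_q` such that the perturbation `e_{n,k} + F` is asymptotically
balanced over `𝔽_q`. -/
theorem exists_unbalanced_perturbation (p r : ℕ) (hp : p.Prime) (hr : 1 ≤ r)
    (K : Type*) [Field K] [Fintype K] [DecidableEq K] (hK : Fintype.card K = p ^ r)
    (k : ℕ) (hk : 1 < k) (pk : K → ℚ)
    (hpk : ∀ β : K, pk β =
      ((Finset.univ.filter (fun b : Kˣ → Fin (p ^ (Nat.log p k + 1)) =>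
          (Mb b).esymm k = β)).card : ℚ) /
        ((p : ℚ) ^ (Nat.log p k + 1)) ^ (p ^ r - 1))
    (hnc : ∃ β : K, pk β ≠ 1 / ((p : ℚ) ^ r))
    (v : K → ℚ) (hv : v ≠ 0)
    (hker : ∀ β : K, ∑ γ : K, pk (β - γ) * v γ = 0) :
    ∃ (j : ℕ), 1 ≤ j ∧ ∃ F : (Fin j → K) → K,
      (¬ ∀ t : K,
        (Finset.univ.filter (fun β : Fin j → K => F β = t)).card = (p ^ r) ^ (j - 1)) ∧
      ∀ γ : K,
        Tendsto
          (fun n : ℕ =>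
            ((Finset.univ.filter (fun x : Fin (j + n) → K =>
                evalE k x + F (fun i => x (Fin.castAdd n i)) = γ)).card : ℝ) /
              ((p : ℝ) ^ r) ^ (j + n))
          atTop (𝓝 (1 / ((p : ℝ) ^ r))) := by
  classical
  have : Fact p.Prime := ⟨hp⟩
  have : CharP K p := charP_of_card_eq_prime_pow hK
  set s := Nat.log p k + 1 with hs
  have hkD : k < p ^ s := Nat.lt_pow_succ_log_self hp.one_lt k
  have : NeZero (p ^ s) := ⟨(pow_pos hp.pos _).ne'⟩
  set D := p ^ s with hD
  have hG : Fintype.card (Kˣ → Fin D) = D ^ (p ^ r - 1) := by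
    rw [Fintype.card_fun, Fintype.card_fin, Fintype.card_units, hK]
  have hpk' : ∀ β : K, pk β =
      ((Finset.univ.filter (fun b : Kˣ → Fin D => (Mb b).esymm k = β)).card : ℚ) /
        (Fintype.card (Kˣ → Fin D) : ℚ) := by
    intro β
    rw [hpk, hG, hD]; push_cast; rfl
  have hG0 : (Fintype.card (Kˣ → Fin D) : ℚ) ≠ 0 := by exact_mod_cast Fintype.card_ne_zero
  have hsum1 : ∑ β, pk β = 1 := by
    simp_rw [hpk']
    rw [← Finset.sum_div, div_eq_one_iff_eq hG0]
    have := Finset.card_eq_sum_card_fiberwise (s := (Finset.univ : Finset (Kˣ → Fin D)))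
      (t := (Finset.univ : Finset K)) (f := fun b => (Mb b).esymm k) (fun _ _ => by simp)
    rw [Finset.card_univ] at this
    rw [this]; push_cast; rfl
  have hshift : ∀ γ : K, ∑ β, pk (β - γ) = 1 := fun γ => by
    rw [← hsum1]; exact (Equiv.subRight γ).sum_comp pk
  have hshift' : ∀ γ : K, ∑ β, pk (γ - β) = 1 := fun γ => by
    rw [← hsum1]; exact (Equiv.subLeft γ).sum_comp pk
  have hv0 : ∑ t, v t = 0 := by
    have h : ∑ β : K, ∑ γ : K, pk (β - γ) * v γ = 0 := Finset.sum_eq_zero fun β _ => hker β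
    rw [Finset.sum_comm] at h
    simpa [← Finset.sum_mul, hshift] using h
  have hq1 : 1 < p ^ r := Nat.one_lt_pow (by omega) hp.one_lt
  obtain ⟨j, hj, m, N, hN, hm, hms⟩ := exists_counts (p ^ r) hq1 hK v hv0
  obtain ⟨F, hF⟩ := exists_fiber (A := Fin j → K) m (by
    rw [hms, Fintype.card_fun, hK, Fintype.card_fin])
  refine ⟨j, hj, F, ?_, ?_⟩
  · intro hbal
    apply hv
    funext t
    have h1 := hm t
    rw [← hF t, hbal t] at h1
    push_cast at h1
    have : N * v t = 0 := by linarith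
    simpa [hN] using this
  · intro γ
    have hqR : ((p : ℝ) ^ r) ≠ 0 := pow_ne_zero _ (by exact_mod_cast hp.ne_zero)
    -- decomposition over the first `j` coordinates
    have hcount : ∀ n : ℕ, (Finset.univ.filter (fun x : Fin (j + n) → K =>
                evalE k x + F (fun i => x (Fin.castAdd n i)) = γ)).card =
        ∑ a : Fin j → K, (Finset.univ.filter (fun y : Fin n → K =>
          (Mb ((∑ i, stp D (a i)) + ∑ i, stp D (y i))).esymm k = γ - F a)).card := by
      intro n
      rw [Finset.card_filter, ← (Fin.appendEquiv j n).sum_comp, Fintype.sum_prod_type]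
      refine Finset.sum_congr rfl fun a _ => ?_
      rw [Finset.card_filter]
      refine Finset.sum_congr rfl fun y _ => ?_
      have h1 : evalE k (Fin.append a y)
          = (Mb ((∑ i, stp D (a i)) + ∑ i, stp D (y i))).esymm k := by
        rw [evalE_eq p s k hkD, Fin.sum_univ_add]
        simp only [Fin.append_left, Fin.append_right]
        rfl
      have h2 : (Fin.appendEquiv j n) (a, y) = Fin.append a y := rfl
      simp only [h2, Fin.append_left, h1, eq_sub_iff_add_eq]
    have hlim : ∀ a : Fin j → K, Tendsto (fun n : ℕ => ((Finset.univ.filter (fun y : Fin n → K =>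
          (Mb ((∑ i, stp D (a i)) + ∑ i, stp D (y i))).esymm k = γ - F a)).card : ℝ)
          / ((p : ℝ) ^ r) ^ n) atTop (𝓝 ((pk (γ - F a) : ℚ) : ℝ)) := by
      intro a
      have := walk_tendsto (K := K) D
        (fun g => (Mb ((∑ i, stp D (a i)) + g)).esymm k = γ - F a)
      rw [hK] at this
      push_cast at this
      convert this using 2
      rw [hpk']
      push_cast
      congr 2
      refine Finset.card_equiv (Equiv.subRight (∑ i, stp D (a i))) fun g => ?_
      simp
    have htot := (tendsto_finsetSum Finset.univ fun a _ => hlim a).div_const (((p : ℝ) ^ r) ^ j)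
    have hval : (∑ a : Fin j → K, ((pk (γ - F a) : ℚ) : ℝ)) / (((p : ℝ) ^ r) ^ j)
        = 1 / ((p : ℝ) ^ r) := by
      have h1 : ∑ a : Fin j → K, pk (γ - F a) = ∑ t : K, (m t : ℚ) * pk (γ - t) := by
        rw [← Finset.sum_fiberwise (s := Finset.univ) (g := F)]
        refine Finset.sum_congr rfl fun t _ => ?_
        rw [← hF t, ← nsmul_eq_mul, ← Finset.sum_const]
        refine Finset.sum_congr rfl fun a ha => ?_
        rw [(Finset.mem_filter.1 ha).2]
      have h2 : ∑ a : Fin j → K, pk (γ - F a) = ((p : ℚ) ^ r) ^ (j - 1) := by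
        rw [h1]
        have h3 : ∀ t, (m t : ℚ) * pk (γ - t) =
            ((p : ℚ) ^ r) ^ (j - 1) * pk (γ - t) + N * (pk (γ - t) * v t) := by
          intro t; rw [hm]; push_cast; ring
        simp_rw [h3]
        rw [Finset.sum_add_distrib, ← Finset.mul_sum, ← Finset.mul_sum, hshift', hker]
        ring
      rw [← Rat.cast_sum, h2]
      obtain ⟨i, rfl⟩ : ∃ i, j = i + 1 := ⟨j - 1, by omega⟩
      push_cast
      rw [pow_succ ((p : ℝ) ^ r) i]
      field_simp
    rw [hval] at htot
    refine htot.congr fun n => ?_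
    rw [hcount]
    push_cast
    rw [← Finset.sum_div, div_div, pow_add, mul_comm]
end

section
/- Let 𝔽_4 be a field with 4 elements and α ∈ 𝔽_4 with α² + α + 1 = 0. Then as n → ∞, the real sequence (1/4^n) · #{x ∈ 𝔽_4^n : e_5(x) = β} converges to 11/32 for β = 0, and converges to 7/32 for each β ∈ {1, α, α+1}. -/
open Filter Topology

abbrev G8 : Type := ZMod 8 × ZMod 8 × ZMod 8

section aux

open Polynomial

lemma esymm_eq_coeff {K : Type*} [CommRing K] (s : Multiset K) :
    ∀ k : ℕ, s.esymm k = ((s.map (fun a => (1 + C a * X : K[X]))).prod).coeff k := by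
  induction s using Multiset.induction_on with
  | empty =>
    intro k
    cases k with
    | zero => simp [Multiset.esymm]
    | succ k => simp [Multiset.esymm, coeff_one, Multiset.powersetCard_zero_right]
  | cons a s ih =>
    intro k
    cases k with
    | zero =>
      have h0 := ih 0
      simp [Multiset.esymm, add_mul, mul_assoc] at h0 ⊢
      exact h0
    | succ k =>
      rw [Multiset.map_cons, Multiset.prod_cons, add_mul, one_mul, mul_assoc, coeff_add,
        coeff_C_mul, coeff_X_mul, ← ih, ← ih]
      simp [Multiset.esymm, Multiset.powersetCard_cons, Multiset.map_map,
        Multiset.sum_map_mul_left]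

lemma char_two {K : Type*} [Field K] [Fintype K] (hK : Fintype.card K = 4) : (2 : K) = 0 := by
  have h : ((Fintype.card K : ℕ) : K) = 0 := Nat.cast_card_eq_zero K
  rw [hK] at h
  have h2 : (2 : K) * 2 = 0 := by
    rw [← h]; norm_num
  simpa using h2

lemma elems {K : Type*} [Field K] [Fintype K] (hK : Fintype.card K = 4) (α : K)
    (hα : α ^ 2 + α + 1 = 0) (k : K) : k = 0 ∨ k = 1 ∨ k = α ∨ k = α + 1 := by
  have h2 := char_two hK
  have h : k ^ 4 = k := by
    have := FiniteField.pow_card k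
    rwa [hK] at this
  have : k * ((k - 1) * ((k - α) * (k - (α + 1)))) = 0 := by
    linear_combination h + (k ^ 2 - k) * hα + (k - k ^ 2 - α * k ^ 3 + α * k ^ 2 - k ^ 3 + k ^ 2) * h2
  simpa [sub_eq_zero] using this

noncomputable def stepG {K : Type*} [Field K] [DecidableEq K] (α : K) (k : K) : G8 :=
  (((if k = 1 then 1 else 0 : ℕ) : ZMod 8), ((if k = α then 1 else 0 : ℕ) : ZMod 8),
    ((if k = α + 1 then 1 else 0 : ℕ) : ZMod 8))

noncomputable def valG {K : Type*} [Field K] (α : K) (g : G8) : K :=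
  ((1 + C 1 * X : K[X]) ^ g.1.val * ((1 + C α * X) ^ g.2.1.val *
    (1 + C (α + 1) * X) ^ g.2.2.val)).coeff 5

lemma pow_mod_dvd {K : Type*} [Field K] (h2 : (2 : K) = 0) (u : K) (n : ℕ) :
    (X ^ 8 : K[X]) ∣ (1 + C u * X) ^ n - (1 + C u * X) ^ (n % 8) := by
  have h2' : (2 : K[X]) = 0 := by
    have := congrArg (C : K → K[X]) h2
    rwa [C_0, map_ofNat] at this
  have h8 : (1 + C u * X : K[X]) ^ 8 = 1 + C u ^ 8 * X ^ 8 := by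
    have sq : ∀ y : K[X], (1 + y) ^ 2 = 1 + y ^ 2 := fun y => by
      linear_combination y * h2'
    calc (1 + C u * X : K[X]) ^ 8 = (((1 + C u * X : K[X]) ^ 2) ^ 2) ^ 2 := by ring
      _ = _ := by rw [sq, sq, sq]; ring
  have e : (1 + C u * X : K[X]) ^ n - (1 + C u * X) ^ (n % 8)
      = (1 + C u * X) ^ (n % 8) * (((1 + C u * X) ^ 8) ^ (n / 8) - 1 ^ (n / 8)) := by
    conv_lhs => rw [← Nat.mod_add_div n 8]
    rw [pow_add, pow_mul]
    simp
    ring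
  rw [e]
  apply Dvd.dvd.mul_left
  refine dvd_trans ?_ (sub_dvd_pow_sub_pow _ _ _)
  rw [h8]
  exact ⟨C u ^ 8, by ring⟩

lemma coeff_congr {K : Type*} [Field K] (h2 : (2 : K) = 0) (u v w : K) (a b c : ℕ) :
    ((1 + C u * X : K[X]) ^ a * ((1 + C v * X) ^ b * (1 + C w * X) ^ c)).coeff 5 =
    ((1 + C u * X : K[X]) ^ (a % 8) * ((1 + C v * X) ^ (b % 8) *
      (1 + C w * X) ^ (c % 8))).coeff 5 := by
  rw [← sub_eq_zero, ← coeff_sub]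
  have : (X ^ 8 : K[X]) ∣ (1 + C u * X : K[X]) ^ a * ((1 + C v * X) ^ b * (1 + C w * X) ^ c) -
      (1 + C u * X : K[X]) ^ (a % 8) * ((1 + C v * X) ^ (b % 8) * (1 + C w * X) ^ (c % 8)) := by
    obtain ⟨p, hp⟩ := pow_mod_dvd h2 u a
    obtain ⟨q, hq⟩ := pow_mod_dvd h2 v b
    obtain ⟨r, hr⟩ := pow_mod_dvd h2 w c
    refine ⟨p * ((1 + C v * X) ^ b * (1 + C w * X) ^ c) +
      (1 + C u * X : K[X]) ^ (a % 8) * (q * (1 + C w * X) ^ c + (1 + C v * X) ^ (b % 8) * r), ?_⟩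
    linear_combination ((1 + C v * X) ^ b * (1 + C w * X) ^ c) * hp +
      (1 + C u * X : K[X]) ^ (a % 8) * ((1 + C w * X) ^ c * hq + (1 + C v * X) ^ (b % 8) * hr)
  exact X_pow_dvd_iff.1 this 5 (by norm_num)

lemma evalE_eq_s12 {K : Type*} [Field K] [Fintype K] [DecidableEq K]
    (hK : Fintype.card K = 4) (α : K) (hα : α ^ 2 + α + 1 = 0) {n : ℕ} (x : Fin n → K) :
    evalE 5 x = valG α (∑ i, stepG α (x i)) := by
  have h2 := char_two hK
  have ha0 : α ≠ 0 := by rintro rfl; simp at hα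
  have ha1 : α ≠ 1 := by
    rintro rfl
    have : (1 : K) = 0 := by linear_combination hα - h2
    exact one_ne_zero this
  have ha2 : α + 1 ≠ 0 := by
    intro h
    have : (1 : K) = 0 := by linear_combination hα - α * h
    exact one_ne_zero this
  have fac : ∀ k : K, (1 + C k * X : K[X]) = (1 + C 1 * X) ^ (if k = 1 then 1 else 0 : ℕ) *
      ((1 + C α * X) ^ (if k = α then 1 else 0 : ℕ) *
      (1 + C (α + 1) * X) ^ (if k = α + 1 then 1 else 0 : ℕ)) := by
    intro k
    rcases elems hK α hα k with rfl | rfl | rfl | rfl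
    · simp [ha0.symm, ha2.symm]
    · simp [ha1.symm, ha0]
    · simp [ha1]
    · simp [ha0]
  have hs : ∑ i, stepG α (x i) = (((∑ i, if x i = 1 then 1 else 0 : ℕ) : ZMod 8),
      ((∑ i, if x i = α then 1 else 0 : ℕ) : ZMod 8),
      ((∑ i, if x i = α + 1 then 1 else 0 : ℕ) : ZMod 8)) := by
    simp only [Prod.ext_iff, Prod.fst_sum, Prod.snd_sum, stepG, Nat.cast_sum, and_self]
  rw [hs, valG]
  simp only [ZMod.val_natCast]
  rw [← coeff_congr h2, evalE, esymm_eq_coeff, Multiset.map_map]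
  congr 1
  change ∏ i, (1 + C (x i) * X : K[X]) = _
  rw [Finset.prod_congr rfl (fun i _ => fac (x i))]
  rw [Finset.prod_mul_distrib, Finset.prod_mul_distrib, Finset.prod_pow_eq_pow_sum,
    Finset.prod_pow_eq_pow_sum, Finset.prod_pow_eq_pow_sum]

def cf (r a b c : ℕ) : ℕ :=
  ((List.range 6).map fun i => ((List.range (6 - i)).map fun j =>
    if (j + 2 * (5 - i - j)) % 3 = r then
      a.choose i * (b.choose j * c.choose (5 - i - j)) else 0).sum).sum

lemma coeff_lin_pow {K : Type*} [Field K] (u : K) (n j : ℕ) :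
    ((1 + C u * X : K[X]) ^ n).coeff j = u ^ j * (n.choose j : K) := by
  have : (1 + C u * X : K[X]) ^ n = ((1 + X : K[X]) ^ n).comp (C u * X) := by simp
  rw [this, comp_C_mul_X_coeff, coeff_one_add_X_pow, mul_comm]

lemma valG_eq {K : Type*} [Field K] (h2 : (2 : K) = 0) (α : K)
    (hα : α ^ 2 + α + 1 = 0) (g : G8) :
    valG α g = ((cf 0 g.1.val g.2.1.val g.2.2.val + cf 2 g.1.val g.2.1.val g.2.2.val : ℕ) : K) +
      ((cf 1 g.1.val g.2.1.val g.2.2.val + cf 2 g.1.val g.2.1.val g.2.2.val : ℕ) : K) * α := by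
  have hsq : α + 1 = α ^ 2 := by linear_combination -hα + (α + 1) * h2
  have h3 : α ^ 3 = 1 := by linear_combination (α - 1) * hα
  have hpow : ∀ m, α ^ m = α ^ (m % 3) := by
    intro m
    conv_lhs => rw [← Nat.mod_add_div m 3, pow_add, pow_mul, h3, one_pow, mul_one]
  have h4 : α ^ 4 = α := by rw [hpow 4]; simp
  have h5 : α ^ 5 = α + 1 := by rw [hsq]; exact hpow 5
  have h6 : α ^ 6 = 1 := by rw [hpow 6]; simp
  have h7 : α ^ 7 = α := by rw [hpow 7]; simp
  have h8 : α ^ 8 = α + 1 := by rw [hsq]; exact hpow 8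
  have h9 : α ^ 9 = 1 := by rw [hpow 9]; simp
  have h10 : α ^ 10 = α := by rw [hpow 10]; simp
  rw [valG, hsq]
  generalize g.1.val = a
  generalize g.2.1.val = b
  generalize g.2.2.val = c
  simp only [coeff_mul, Finset.Nat.sum_antidiagonal_eq_sum_range_succ_mk, coeff_lin_pow, cf,
    ← pow_mul]
  simp [Finset.sum_range_succ, List.range_succ]
  ring_nf
  simp only [h3, h4, h5, h6, h7, h8, h9, h10, ← hsq]
  ring

end aux

section fourier

lemma norm_one_add_lt {z : ℂ} (hz : ‖z‖ = 1) (h1 : z ≠ 1) : ‖1 + z‖ < 2 := by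
  have hs : Complex.normSq z = 1 := by rw [Complex.normSq_eq_norm_sq, hz]; norm_num
  have hs' := hs
  rw [Complex.normSq_apply] at hs'
  have hre : z.re < 1 := by
    by_contra hcon
    push Not at hcon
    have him : z.im = 0 := by nlinarith [mul_self_nonneg z.im]
    have hr : z.re = 1 := by nlinarith
    exact h1 (Complex.ext (by simpa using hr) (by simpa using him))
  have : ‖1 + z‖ ^ 2 < 2 ^ 2 := by
    rw [← Complex.normSq_eq_norm_sq, Complex.normSq_apply]
    simp
    nlinarith
  exact lt_of_pow_lt_pow_left₀ 2 (by norm_num) this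

lemma univ_eq {K : Type*} [Field K] [Fintype K] [DecidableEq K]
    (hK : Fintype.card K = 4) (α : K) (hα : α ^ 2 + α + 1 = 0) :
    α ≠ 0 ∧ α ≠ 1 ∧ α + 1 ≠ 0 ∧ (Finset.univ : Finset K) = {0, 1, α, α + 1} := by
  have h2 := char_two hK
  have ha0 : α ≠ 0 := by rintro rfl; simp at hα
  have ha1 : α ≠ 1 := by
    rintro rfl
    have : (1 : K) = 0 := by linear_combination hα - h2
    exact one_ne_zero this
  have ha2 : α + 1 ≠ 0 := by
    intro h
    have : (1 : K) = 0 := by linear_combination hα - α * h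
    exact one_ne_zero this
  refine ⟨ha0, ha1, ha2, ?_⟩
  ext k
  simpa using elems hK α hα k

lemma sum_K {K : Type*} [Field K] [Fintype K] [DecidableEq K]
    (hK : Fintype.card K = 4) (α : K) (hα : α ^ 2 + α + 1 = 0) (f : G8 → ℂ) :
    ∑ k, f (stepG α k) = f 0 + (f (1, 0, 0) + (f (0, 1, 0) + f (0, 0, 1))) := by
  obtain ⟨ha0, ha1, ha2, hu⟩ := univ_eq hK α hα
  rw [hu, Finset.sum_insert, Finset.sum_insert, Finset.sum_insert, Finset.sum_singleton]
  · congr 1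
    · simp [stepG, ha0.symm, ha2.symm]
      rfl
    · congr 1
      · simp [stepG, ha1.symm, ha0]
      · congr 1
        · simp [stepG, ha1]
        · simp [stepG, ha0]
  · simp
  · simp [ha1.symm, ha0]
  · simp [ha0.symm, ha2.symm]

lemma char_sum_lt {K : Type*} [Field K] [Fintype K] [DecidableEq K]
    (hK : Fintype.card K = 4) (α : K) (hα : α ^ 2 + α + 1 = 0) (χ : AddChar G8 ℂ)
    (hχ : χ ≠ 0) : ‖(∑ k, χ (stepG α k)) / 4‖ < 1 := by
  have key : ‖1 + (χ (1, 0, 0) + (χ (0, 1, 0) + χ (0, 0, 1)))‖ < 4 := by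
    have n1 := AddChar.norm_apply χ ((1, 0, 0) : G8)
    have n2 := AddChar.norm_apply χ ((0, 1, 0) : G8)
    have n3 := AddChar.norm_apply χ ((0, 0, 1) : G8)
    have hne : χ (1, 0, 0) ≠ 1 ∨ χ (0, 1, 0) ≠ 1 ∨ χ (0, 0, 1) ≠ 1 := by
      by_contra hcon
      push Not at hcon
      obtain ⟨e1, e2, e3⟩ := hcon
      apply hχ
      ext g
      obtain ⟨a, b, c⟩ := g
      have : ((a, b, c) : G8) = a.val • ((1, 0, 0) : G8) + (b.val • ((0, 1, 0) : G8) +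
          c.val • ((0, 0, 1) : G8)) := by
        simp
      rw [this, AddChar.map_add_eq_mul, AddChar.map_add_eq_mul, AddChar.map_nsmul_eq_pow,
        AddChar.map_nsmul_eq_pow, AddChar.map_nsmul_eq_pow, e1, e2, e3]
      simp
    generalize χ (1, 0, 0) = z1 at *
    generalize χ (0, 1, 0) = z2 at *
    generalize χ (0, 0, 1) = z3 at *
    rcases hne with h | h | h
    · have := norm_one_add_lt n1 h
      calc ‖1 + (z1 + (z2 + z3))‖ = ‖(1 + z1) + (z2 + z3)‖ := by ring_nf
        _ ≤ ‖1 + z1‖ + (‖z2‖ + ‖z3‖) := (norm_add_le _ _).trans (by gcongr; exact norm_add_le _ _)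
        _ < 4 := by linarith
    · have := norm_one_add_lt n2 h
      calc ‖1 + (z1 + (z2 + z3))‖ = ‖(1 + z2) + (z1 + z3)‖ := by ring_nf
        _ ≤ ‖1 + z2‖ + (‖z1‖ + ‖z3‖) := (norm_add_le _ _).trans (by gcongr; exact norm_add_le _ _)
        _ < 4 := by linarith
    · have := norm_one_add_lt n3 h
      calc ‖1 + (z1 + (z2 + z3))‖ = ‖(1 + z3) + (z1 + z2)‖ := by ring_nf
        _ ≤ ‖1 + z3‖ + (‖z1‖ + ‖z2‖) := (norm_add_le _ _).trans (by gcongr; exact norm_add_le _ _)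
        _ < 4 := by linarith
  rw [sum_K hK α hα, AddChar.map_zero_eq_one, norm_div]
  simp only [Complex.norm_ofNat]
  linarith

lemma char_map_sum (χ : AddChar G8 ℂ) {ι : Type*} (s : Finset ι) (f : ι → G8) :
    χ (∑ i ∈ s, f i) = ∏ i ∈ s, χ (f i) := by
  classical
  induction s using Finset.induction_on with
  | empty => simp
  | insert a s ha ih =>
    rw [Finset.sum_insert ha, Finset.prod_insert ha, AddChar.map_add_eq_mul, ih]

lemma count_eq {K : Type*} [Field K] [Fintype K] [DecidableEq K] (α : K) (g : G8) (n : ℕ) :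
    ((Finset.univ.filter (fun x : Fin n → K => ∑ i, stepG α (x i) = g)).card : ℂ) * 512 =
      ∑ χ : AddChar G8 ℂ, χ (-g) * (∑ k, χ (stepG α k)) ^ n := by
  have h1 : ∀ χ : AddChar G8 ℂ, χ (-g) * (∑ k, χ (stepG α k)) ^ n =
      ∑ x : Fin n → K, χ ((∑ i, stepG α (x i)) - g) := by
    intro χ
    rw [Fintype.sum_pow, Finset.mul_sum]
    refine Finset.sum_congr rfl fun x _ => ?_
    rw [sub_eq_neg_add, AddChar.map_add_eq_mul, char_map_sum]
  rw [Finset.sum_congr rfl (fun χ _ => h1 χ), Finset.sum_comm]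
  simp only [AddChar.sum_apply_eq_ite, sub_eq_zero]
  rw [Finset.card_filter, Nat.cast_sum, Finset.sum_mul]
  refine Finset.sum_congr rfl fun x _ => ?_
  split_ifs <;> simp [Fintype.card_prod, ZMod.card]

lemma count_tendsto {K : Type*} [Field K] [Fintype K] [DecidableEq K]
    (hK : Fintype.card K = 4) (α : K) (hα : α ^ 2 + α + 1 = 0) (g : G8) :
    Tendsto (fun n : ℕ =>
        ((Finset.univ.filter (fun x : Fin n → K => ∑ i, stepG α (x i) = g)).card : ℝ) /
          (4 : ℝ) ^ n) atTop (𝓝 (1 / 512)) := by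
  classical
  have hc : Tendsto (fun n : ℕ =>
        (∑ χ : AddChar G8 ℂ, χ (-g) * ((∑ k, χ (stepG α k)) / 4) ^ n) / 512) atTop
        (𝓝 ((∑ χ : AddChar G8 ℂ, if χ = 0 then 1 else 0) / 512)) := by
    refine Tendsto.div_const (tendsto_finsetSum _ fun χ _ => ?_) _
    split_ifs with h
    · subst h
      simp [hK]
    · have := (tendsto_pow_atTop_nhds_zero_of_norm_lt_one (char_sum_lt hK α hα χ h)).const_mul
        (χ (-g))
      simpa using this
  rw [Finset.sum_ite_eq' Finset.univ (0 : AddChar G8 ℂ), if_pos (Finset.mem_univ _)] at hc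
  have hre := (Complex.continuous_re.tendsto _).comp hc
  have e : ((1 : ℂ) / 512).re = 1 / 512 := by
    have : ((1 : ℂ) / 512) = ((1 / 512 : ℝ) : ℂ) := by push_cast; rfl
    rw [this, Complex.ofReal_re]
  rw [e] at hre
  refine hre.congr fun n => ?_
  have hh : (∑ χ : AddChar G8 ℂ, χ (-g) * ((∑ k, χ (stepG α k)) / 4) ^ n) / 512 =
      ((((Finset.univ.filter (fun x : Fin n → K => ∑ i, stepG α (x i) = g)).card : ℝ) /
          (4 : ℝ) ^ n : ℝ) : ℂ) := by
    have hce := count_eq α g n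
    simp only [div_pow, mul_div_assoc']
    rw [← Finset.sum_div, ← hce]
    push_cast
    field_simp
  simp only [Function.comp_apply]
  rw [hh, Complex.ofReal_re]

lemma value_tendsto {K : Type*} [Field K] [Fintype K] [DecidableEq K]
    (hK : Fintype.card K = 4) (α : K) (hα : α ^ 2 + α + 1 = 0) (β : K) (m : ℕ) (l : ℝ)
    (hm : (Finset.univ.filter (fun g : G8 => valG α g = β)).card = m) (hl : l = m / 512) :
    Tendsto (fun n : ℕ =>
        ((Finset.univ.filter (fun x : Fin n → K => evalE 5 x = β)).card : ℝ) / (4 : ℝ) ^ n)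
      atTop (𝓝 l) := by
  have h := tendsto_finsetSum (Finset.univ.filter (fun g : G8 => valG α g = β))
    (fun g _ => count_tendsto hK α hα g)
  rw [Finset.sum_const, hm, nsmul_eq_mul, mul_one_div, ← hl] at h
  refine h.congr fun n => ?_
  rw [← Finset.sum_div, ← Nat.cast_sum]
  congr 2
  rw [Finset.card_eq_sum_card_fiberwise (f := fun x : Fin n → K => ∑ i, stepG α (x i))
    (t := Finset.univ.filter (fun g : G8 => valG α g = β))]
  · refine Finset.sum_congr rfl fun g hg => ?_
    congr 1
    ext x
    simp only [Finset.mem_filter, Finset.mem_univ, true_and] at hg ⊢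
    rw [evalE_eq_s12 hK α hα]
    constructor
    · intro hx
      exact ⟨by rw [hx]; exact hg, hx⟩
    · exact fun hx => hx.2
  · intro x hx
    simpa [evalE_eq_s12 hK α hα] using hx

end fourier

def pc (g : G8) : ℕ :=
  (cf 0 g.1.val g.2.1.val g.2.2.val + cf 2 g.1.val g.2.1.val g.2.2.val) % 2

def qc (g : G8) : ℕ :=
  (cf 1 g.1.val g.2.1.val g.2.2.val + cf 2 g.1.val g.2.1.val g.2.2.val) % 2

lemma card00 : (Finset.univ.filter (fun g : G8 => pc g = 0 ∧ qc g = 0)).card = 176 := by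
  decide +kernel

lemma card10 : (Finset.univ.filter (fun g : G8 => pc g = 1 ∧ qc g = 0)).card = 112 := by
  decide +kernel

lemma card01 : (Finset.univ.filter (fun g : G8 => pc g = 0 ∧ qc g = 1)).card = 112 := by
  decide +kernel

lemma card11 : (Finset.univ.filter (fun g : G8 => pc g = 1 ∧ qc g = 1)).card = 112 := by
  decide +kernel

lemma valG_pq {K : Type*} [Field K] (h2 : (2 : K) = 0) (α : K)
    (hα : α ^ 2 + α + 1 = 0) (g : G8) : valG α g = (pc g : K) + (qc g : K) * α := by
  have hmod : ∀ m : ℕ, (m : K) = ((m % 2 : ℕ) : K) := by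
    intro m
    conv_lhs => rw [← Nat.mod_add_div m 2]
    push_cast
    rw [h2]
    ring
  rw [valG_eq h2 α hα, hmod, hmod (cf 1 _ _ _ + _)]
  rfl

lemma valG_iff {K : Type*} [Field K] [Fintype K] [DecidableEq K]
    (hK : Fintype.card K = 4) (α : K) (hα : α ^ 2 + α + 1 = 0) (g : G8) :
    (valG α g = 0 ↔ pc g = 0 ∧ qc g = 0) ∧ (valG α g = 1 ↔ pc g = 1 ∧ qc g = 0) ∧
    (valG α g = α ↔ pc g = 0 ∧ qc g = 1) ∧ (valG α g = α + 1 ↔ pc g = 1 ∧ qc g = 1) := by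
  obtain ⟨ha0, ha1, ha2, -⟩ := univ_eq hK α hα
  rw [valG_pq (char_two hK) α hα]
  have hp : pc g = 0 ∨ pc g = 1 := by unfold pc; omega
  have hq : qc g = 0 ∨ qc g = 1 := by unfold qc; omega
  rcases hp with hp | hp <;> rcases hq with hq | hq <;>
    simp [hp, hq, ha0, ha1, ha2, ha0.symm, ha1.symm, ha2.symm, add_comm (1 : K) α]

/-- **Example 3.3.** Over `𝔽_4 = 𝔽_2(α)` with `α² + α + 1 = 0`, the limiting
value distribution of `e_5` is `11/32` at `0` and `7/32` at each of `1`, `α`, `α + 1`. -/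
theorem limit_distribution_F4_e5 (K : Type*) [Field K] [Fintype K] [DecidableEq K]
    (hK : Fintype.card K = 4) (α : K) (hα : α ^ 2 + α + 1 = 0) :
    Tendsto (fun n : ℕ =>
        ((Finset.univ.filter (fun x : Fin n → K => evalE 5 x = 0)).card : ℝ) / (4 : ℝ) ^ n)
      atTop (𝓝 (11 / 32)) ∧
    Tendsto (fun n : ℕ =>
        ((Finset.univ.filter (fun x : Fin n → K => evalE 5 x = 1)).card : ℝ) / (4 : ℝ) ^ n)
      atTop (𝓝 (7 / 32)) ∧
    Tendsto (fun n : ℕ =>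
        ((Finset.univ.filter (fun x : Fin n → K => evalE 5 x = α)).card : ℝ) / (4 : ℝ) ^ n)
      atTop (𝓝 (7 / 32)) ∧
    Tendsto (fun n : ℕ =>
        ((Finset.univ.filter (fun x : Fin n → K => evalE 5 x = α + 1)).card : ℝ) / (4 : ℝ) ^ n)
      atTop (𝓝 (7 / 32)) := by
  have h := valG_iff hK α hα
  refine ⟨value_tendsto hK α hα 0 176 _ ?_ (by norm_num),
    value_tendsto hK α hα 1 112 _ ?_ (by norm_num),
    value_tendsto hK α hα α 112 _ ?_ (by norm_num),
    value_tendsto hK α hα (α + 1) 112 _ ?_ (by norm_num)⟩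
  · rw [← card00]; congr 1; ext g; simp [(h g).1]
  · rw [← card10]; congr 1; ext g; simp [(h g).2.1]
  · rw [← card01]; congr 1; ext g; simp [(h g).2.2.1]
  · rw [← card11]; congr 1; ext g; simp [(h g).2.2.2]
end
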